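/- Theorem 1 (Convergence to optima). Assume: (i) f(w(u),u) = 0 for all u ∈ ℝ^m; (ii) (∂h_i/∂u)(x,u) = 0 for all (x,u) ∈ ℝ^n × ℝ^m and all i < r; (iii) there exist a continuously differentiable function W : ℝ^n × ℝ^m → ℝ and constants d₁, d₂, d₃, d₄ > 0 such that for all (x,u): d₁·‖x − w(u)‖² ≤ W(x,u) ≤ d₂·‖x − w(u)‖², (∂W/∂x)(x,u)·f(x,u) ≤ −d₃·‖x − w(u)‖², and ‖(∂W/∂u)(x,u)‖ ≤ d₄·‖x − w(u)‖; (iv) the function u ↦ Φ(w(u)) has compact sublevel sets; (v) the point (x*,u*) satisfies x* = w(u*), b(u*) ≥ 0 and h(x*) > 0; (vi) there is an open neighborhood N of (x*,u*) such that Φ(w(u)) > Φ(w(u*)) for every (x,u) ∈ N with u ≠ u*, and, for every choice of the parameters ε, α, γ > 0: QP(x,u) has nonempty feasible set for every (x,u) ∈ N, the map g(x,u) := (the unique minimizer of QP(x,u)) is locally Lipschitz on N, and (x*,u*) is the only point (x,u) ∈ N with x = w(u) and g(x,u) = 0. Then, for any fixed α > 0, there exist ε* > 0 and γ* > 0 such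 that for every ε ∈ (0, ε*) and every γ ≥ γ*, the point (x*,u*) is locally asymptotically stable relative to X_r for the closed-loop system ξ'(t) = f(ξ(t),υ(t)), υ'(t) = g(ξ(t),υ(t)); that is, for every neighborhood V of (x*,u*) there is a neighborhood V' of (x*,u*) such that every solution of the closed loop with initial condition in V' ∩ X_r is defined for all t ≥ 0, remains in V for all t ≥ 0, and converges to (x*,u*) as t → ∞. -/

import Mathlib

open Set Filter Topology
open scoped RealInnerProductSpace

noncomputable def hseq {n m : ℕ}
    (f : EuclideanSpace ℝ (Fin n) × EuclideanSpace ℝ (Fin m) → EuclideanSpace ℝ (Fin n))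
    (h : EuclideanSpace ℝ (Fin n) → ℝ) (β : ℝ) :
    ℕ → EuclideanSpace ℝ (Fin n) × EuclideanSpace ℝ (Fin m) → ℝ
  | 0 => fun p => h p.1
  | i + 1 => fun p =>
      fderiv ℝ (fun x => hseq f h β i (x, p.2)) p.1 (f p) + β * hseq f h β i p

noncomputable def Xset {n m : ℕ}
    (f : EuclideanSpace ℝ (Fin n) × EuclideanSpace ℝ (Fin m) → EuclideanSpace ℝ (Fin n))
    (h : EuclideanSpace ℝ (Fin n) → ℝ) (b : EuclideanSpace ℝ (Fin m) → ℝ) (β : ℝ) (i : ℕ) :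
    Set (EuclideanSpace ℝ (Fin n) × EuclideanSpace ℝ (Fin m)) :=
  {p | 0 ≤ h p.1 ∧ 0 ≤ b p.2 ∧ 0 ≤ hseq f h β i p}

noncomputable def QPfeas {n m : ℕ}
    (f : EuclideanSpace ℝ (Fin n) × EuclideanSpace ℝ (Fin m) → EuclideanSpace ℝ (Fin n))
    (h : EuclideanSpace ℝ (Fin n) → ℝ) (b : EuclideanSpace ℝ (Fin m) → ℝ) (β : ℝ)
    (r : ℕ) (α γ : ℝ) (p : EuclideanSpace ℝ (Fin n) × EuclideanSpace ℝ (Fin m)) :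
    Set (EuclideanSpace ℝ (Fin m)) :=
  {q | 0 ≤ ⟪gradient b p.2, q⟫ + α * b p.2 ∧
       0 ≤ fderiv ℝ (fun x => hseq f h β r (x, p.2)) p.1 (f p)
         + fderiv ℝ (fun u => hseq f h β r (p.1, u)) p.2 q + γ * hseq f h β r p}

noncomputable def QPobj {n m : ℕ}
    (Φ : EuclideanSpace ℝ (Fin n) → ℝ) (w : EuclideanSpace ℝ (Fin m) → EuclideanSpace ℝ (Fin n))
    (ε : ℝ) (p : EuclideanSpace ℝ (Fin n) × EuclideanSpace ℝ (Fin m))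
    (q : EuclideanSpace ℝ (Fin m)) : ℝ :=
  (1 / 2) * ‖q + ε • (ContinuousLinearMap.adjoint (fderiv ℝ w p.2)) (gradient Φ p.1)‖ ^ 2

noncomputable def lieD {n m : ℕ}
    (f : EuclideanSpace ℝ (Fin n) × EuclideanSpace ℝ (Fin m) → EuclideanSpace ℝ (Fin n))
    (h : EuclideanSpace ℝ (Fin n) → ℝ) :
    ℕ → EuclideanSpace ℝ (Fin n) × EuclideanSpace ℝ (Fin m) → ℝ
  | 0 => fun p => h p.1
  | i + 1 => fun p => fderiv ℝ (fun x => lieD f h i (x, p.2)) p.1 (f p)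

theorem LipschitzWith.exists_global_solution {E : Type*} [NormedAddCommGroup E] [NormedSpace ℝ E]
    [CompleteSpace E] {G : E → E} {K : NNReal} (hG : LipschitzWith K G) {M : ℝ}
    (hM : ∀ x, ‖G x‖ ≤ M) (x₀ : E) :
    ∃ y : ℝ → E, y 0 = x₀ ∧ ∀ t ∈ Ici (0 : ℝ), HasDerivWithinAt y (G (y t)) (Ici 0) t := by
  have hlocal : ∀ k : ℕ, ∃ y : ℝ → E, y 0 = x₀ ∧
      ∀ t ∈ Icc (0 : ℝ) k, HasDerivWithinAt y (G (y t)) (Icc 0 k) t := by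
    intro k
    have hP : IsPicardLindelof (fun _ : ℝ => G)
        (⟨0, left_mem_Icc.2 k.cast_nonneg⟩ : Icc (0 : ℝ) k) x₀ (M.toNNReal * k) 0
        M.toNNReal K :=
      IsPicardLindelof.of_time_independent
        (fun x _ => (hM x).trans (Real.le_coe_toNNReal M)) hG.lipschitzOnWith (by simp)
    exact hP.exists_eq_forall_mem_Icc_hasDerivWithinAt₀
  choose y hy0 hy using hlocal
  have hright : ∀ k : ℕ, ∀ t ∈ Ico (0 : ℝ) k, HasDerivWithinAt (y k) (G (y k t)) (Ici t) t := by
    intro k t ht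
    refine (hy k t (Ico_subset_Icc_self ht)).mono_of_mem_nhdsWithin ?_
    exact mem_of_superset (Icc_mem_nhdsGE ht.2) (Icc_subset_Icc_left ht.1)
  have hagree : ∀ j k : ℕ, j ≤ k → EqOn (y j) (y k) (Icc 0 j) := by
    intro j k hjk
    have hjk' : (j : ℝ) ≤ k := by exact_mod_cast hjk
    refine ODE_solution_unique (v := fun _ => G) (fun _ => hG)
      (fun t ht => (hy j t ht).continuousWithinAt) (hright j)
      (fun t ht => ((hy k t (Icc_subset_Icc_right hjk' ht)).continuousWithinAt).mono
        (Icc_subset_Icc_right hjk'))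
      (fun t ht => hright k t ⟨ht.1, ht.2.trans_le hjk'⟩) ?_
    rw [hy0, hy0]
  have hglue : ∀ k : ℕ, ∀ t ∈ Icc (0 : ℝ) k, y ⌈t⌉₊ t = y k t := fun k t ht =>
    hagree _ k (Nat.ceil_le.2 ht.2) ⟨ht.1, Nat.le_ceil t⟩
  refine ⟨fun t => y ⌈t⌉₊ t, hy0 _, fun t (ht : 0 ≤ t) => ?_⟩
  obtain ⟨k, hk⟩ := exists_nat_gt t
  have hmem : Icc (0 : ℝ) k ∈ 𝓝[Ici 0] t := by
    rw [← Ici_inter_Iic]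
    exact inter_mem self_mem_nhdsWithin (mem_nhdsWithin_of_mem_nhds (Iic_mem_nhds hk))
  have htk : t ∈ Icc (0 : ℝ) k := ⟨ht, hk.le⟩
  simp only [hglue k t htk]
  exact ((hy k t htk).mono_of_mem_nhdsWithin hmem).congr_of_eventuallyEq
    (mem_of_superset hmem (hglue k)) (hglue k t htk)

theorem LipschitzOnWith.exists_bounded_extension {E : Type*} [PseudoMetricSpace E] {k : ℕ}
    {F : E → EuclideanSpace ℝ (Fin k)} {K : NNReal} {s : Set E} (hF : LipschitzOnWith K F s)
    {M : ℝ} (hM : ∀ x ∈ s, ‖F x‖ ≤ M) :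
    ∃ (G : E → EuclideanSpace ℝ (Fin k)) (K' : NNReal) (M' : ℝ),
      LipschitzWith K' G ∧ EqOn F G s ∧ ∀ x, ‖G x‖ ≤ M' := by
  obtain ⟨H, hH, hFH⟩ := ((PiLp.lipschitzWith_ofLp 2 (fun _ : Fin k => ℝ)).comp_lipschitzOnWith
    hF).extend_pi
  have hclamp : LipschitzWith (1 * K) fun x i => max (-M) (min M (H x i)) :=
    LipschitzWith.of_dist_le_mul fun x z => (dist_pi_le_iff (by positivity)).2 fun i =>
      ((((LipschitzWith.eval i).comp hH).const_min M).const_max (-M)).dist_le_mul x z |>.trans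
        (by simp)
  have hcpt : IsCompact (WithLp.toLp 2 '' Icc (fun _ : Fin k => -M ⊓ M) fun _ => -M ⊔ M) :=
    isCompact_Icc.image (PiLp.continuous_toLp 2 _)
  obtain ⟨M', hM'⟩ := hcpt.isBounded.exists_norm_le
  refine ⟨fun x => WithLp.toLp 2 fun i => max (-M) (min M (H x i)), _, M',
    (PiLp.lipschitzWith_toLp 2 (fun _ : Fin k => ℝ)).comp hclamp, fun x hx => ?_,
    fun x => hM' _ ⟨_, ⟨fun i => ?_, fun i => ?_⟩, rfl⟩⟩
  · ext i
    have h1 : F x i = H x i := congrFun (hFH hx) i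
    have h2 : |F x i| ≤ M := (PiLp.norm_apply_le (F x) i).trans (hM x hx)
    rw [abs_le] at h2
    simp only [← h1]
    rw [min_eq_right h2.2, max_eq_right h2.1]
  · exact inf_le_left.trans (le_max_left _ _)
  · exact sup_le_sup_left (min_le_left _ _) _

theorem exists_nhds_stable_and_attracted {E : Type*} [MetricSpace E] [ProperSpace E]
    {p₀ : E} {ρ : ℝ} (hρ : 0 < ρ) {V D : E → ℝ}
    (hV : ContinuousOn V (Metric.closedBall p₀ ρ)) (hV0 : V p₀ = 0)
    (hVpos : ∀ p ∈ Metric.closedBall p₀ ρ, p ≠ p₀ → 0 < V p)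
    (hD : ContinuousOn D (Metric.closedBall p₀ ρ))
    (hD0 : ∀ p ∈ Metric.closedBall p₀ ρ, 0 ≤ D p)
    (hDpos : ∀ p ∈ Metric.closedBall p₀ ρ, p ≠ p₀ → 0 < D p) :
    ∃ U ∈ 𝓝 p₀, ∀ y : ℝ → E, ContinuousOn y (Ici 0) → y 0 ∈ U →
      (∀ t, 0 ≤ t → (∀ s ∈ Icc 0 t, y s ∈ Metric.closedBall p₀ ρ) →
        ∃ v', HasDerivWithinAt (fun s => V (y s)) v' (Ici 0) t ∧ v' ≤ -D (y t)) →
      (∀ t, 0 ≤ t → y t ∈ Metric.ball p₀ ρ) ∧ Tendsto y atTop (𝓝 p₀) := by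
  have hcpt : IsCompact (Metric.closedBall p₀ ρ) := isCompact_closedBall p₀ ρ
  have hpos_away : ∀ {F : E → ℝ}, ContinuousOn F (Metric.closedBall p₀ ρ) →
      (∀ p ∈ Metric.closedBall p₀ ρ, p ≠ p₀ → 0 < F p) → ∀ η > 0,
      ∃ c > 0, ∀ p ∈ Metric.closedBall p₀ ρ, p ∉ Metric.ball p₀ η → c ≤ F p := by
    intro F hF hFpos η hη
    obtain ⟨c, hc, hle⟩ := (hcpt.diff (Metric.isOpen_ball (x := p₀) (ε := η))).exists_forall_le'
      (hF.mono sdiff_subset) (a := 0) fun p hp => hFpos p hp.1 fun h =>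
        hp.2 (h ▸ Metric.mem_ball_self hη)
    exact ⟨c, hc, fun p hp hp' => hle p ⟨hp, hp'⟩⟩
  obtain ⟨c, hc, hcV⟩ := hpos_away hV hVpos ρ hρ
  have hVat : ContinuousAt V p₀ := hV.continuousAt (Metric.closedBall_mem_nhds p₀ hρ)
  have hUnhds : {p | V p < c} ∩ Metric.ball p₀ ρ ∈ 𝓝 p₀ :=
    inter_mem (hVat.eventually_lt_const (by rwa [hV0])) (Metric.ball_mem_nhds p₀ hρ)
  refine ⟨_, hUnhds, fun y hy hy0 hdecr => ?_⟩
  have hdescent : ∀ δ s t : ℝ, 0 ≤ s → s ≤ t →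
      (∀ τ ∈ Icc 0 t, y τ ∈ Metric.closedBall p₀ ρ) → (∀ τ ∈ Icc s t, δ ≤ D (y τ)) →
      V (y t) + δ * t ≤ V (y s) + δ * s := by
    intro δ s t hs hst hball hδ
    have hder : ∀ τ ∈ Icc s t, ∃ v', HasDerivWithinAt (fun s => V (y s)) v' (Ici 0) τ ∧
        v' ≤ -D (y τ) := fun τ hτ =>
      hdecr τ (hs.trans hτ.1) fun σ hσ => hball σ ⟨hσ.1, hσ.2.trans hτ.2⟩
    have hsub : Icc s t ⊆ Ici 0 := fun τ hτ => hs.trans hτ.1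
    have hd : ∀ τ ∈ Icc s t, DifferentiableWithinAt ℝ (fun τ => V (y τ)) (Ici 0) τ :=
      fun τ hτ => let ⟨_, h, _⟩ := hder τ hτ; h.differentiableWithinAt
    have hanti : AntitoneOn (fun τ => V (y τ) + δ * τ) (Icc s t) := by
      refine antitoneOn_of_hasDerivWithinAt_nonpos (convex_Icc s t)
        (f' := fun τ => derivWithin (fun τ => V (y τ)) (Ici 0) τ + δ * 1) ?_ ?_ ?_
      · exact ContinuousOn.add (fun τ hτ => (hd τ hτ).continuousWithinAt.mono hsub) (by fun_prop)
      · intro τ hτ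
        have hτ' := interior_subset hτ
        exact ((hd τ hτ').hasDerivWithinAt.mono (interior_subset.trans hsub)).add
          ((hasDerivWithinAt_id τ _).const_mul δ)
      · intro τ hτ
        have hτ' := interior_subset hτ
        obtain ⟨v', hv', hle⟩ := hder τ hτ'
        rw [hv'.derivWithin (uniqueDiffOn_Ici 0 τ (hsub hτ'))]
        linarith [hδ τ hτ']
    exact hanti (left_mem_Icc.2 hst) (right_mem_Icc.2 hst) hst
  have hstay : ∀ t, 0 ≤ t → y t ∈ Metric.ball p₀ ρ := by
    by_contra! hexit
    obtain ⟨t₁, ht₁, hyt₁⟩ := hexit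
    set A : Set ℝ := Ici 0 ∩ y ⁻¹' (Metric.ball p₀ ρ)ᶜ
    have hAclosed : IsClosed A :=
      hy.preimage_isClosed_of_isClosed isClosed_Ici Metric.isOpen_ball.isClosed_compl
    have hAbdd : BddBelow A := ⟨0, fun t ht => ht.1⟩
    have hAmem : sInf A ∈ A := hAclosed.csInf_mem ⟨t₁, ht₁, hyt₁⟩ hAbdd
    have hbefore : ∀ s, 0 ≤ s → s < sInf A → y s ∈ Metric.ball p₀ ρ := by
      intro s hs hlt
      by_contra hns
      exact hlt.not_ge (csInf_le hAbdd ⟨hs, hns⟩)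
    have hpos : 0 < sInf A := by
      refine lt_of_le_of_ne hAmem.1 fun h0 => hAmem.2 ?_
      rw [← h0]
      exact hy0.2
    have hend : y (sInf A) ∈ Metric.closedBall p₀ ρ := by
      have hlim : Tendsto y (𝓝[Ico 0 (sInf A)] sInf A) (𝓝 (y (sInf A))) :=
        (hy _ hAmem.1).mono Ico_subset_Ici_self
      have : (𝓝[Ico 0 (sInf A)] sInf A).NeBot := by
        rw [nhdsWithin_Ico_eq_nhdsLT hpos]
        infer_instance
      exact Metric.isClosed_closedBall.mem_of_tendsto hlim <|
        eventually_of_mem self_mem_nhdsWithin fun s hs =>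
          Metric.ball_subset_closedBall (hbefore s hs.1 hs.2)
    have hball : ∀ s ∈ Icc 0 (sInf A), y s ∈ Metric.closedBall p₀ ρ := by
      intro s hs
      rcases hs.2.eq_or_lt with h | h
      · rwa [h]
      · exact Metric.ball_subset_closedBall (hbefore s hs.1 h)
    have h1 := hdescent 0 0 (sInf A) le_rfl hpos.le hball fun τ hτ => hD0 _ (hball τ hτ)
    have h2 := hcV _ hend hAmem.2
    have h3 : V (y 0) < c := hy0.1
    linarith
  have hball : ∀ t, 0 ≤ t → y t ∈ Metric.closedBall p₀ ρ := fun t ht =>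
    Metric.ball_subset_closedBall (hstay t ht)
  refine ⟨hstay, Metric.tendsto_atTop.2 fun η hη => ?_⟩
  obtain ⟨v, hv, hvV⟩ := hpos_away hV hVpos η hη
  obtain ⟨T, hT, hVT⟩ : ∃ T, 0 ≤ T ∧ V (y T) < v := by
    by_contra! hge
    obtain ⟨η', hη', hsmall⟩ := Metric.eventually_nhds_iff_ball.1
      (hVat.eventually_lt_const (show V p₀ < v by rwa [hV0]))
    obtain ⟨δ, hδ, hδD⟩ := hpos_away hD hDpos η' hη'
    have hDδ : ∀ τ, 0 ≤ τ → δ ≤ D (y τ) := fun τ hτ =>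
      hδD _ (hball τ hτ) fun hmem => (hge τ hτ).not_gt (hsmall _ hmem)
    have hVy0 : 0 ≤ V (y 0) := hv.le.trans (hge 0 le_rfl)
    have ht : 0 ≤ V (y 0) / δ := by positivity
    have h1 := hdescent δ 0 (V (y 0) / δ) le_rfl ht (fun τ hτ => hball τ hτ.1)
      fun τ hτ => hDδ τ hτ.1
    rw [mul_div_cancel₀ _ hδ.ne'] at h1
    linarith [hge _ ht]
  refine ⟨T, fun t htT => ?_⟩
  have h1 := hdescent 0 T t hT htT (fun τ hτ => hball τ hτ.1)
    fun τ hτ => hD0 _ (hball τ (hT.trans hτ.1))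
  by_contra hnear
  linarith [hvV _ (hball t (hT.trans htT)) hnear]

theorem nonneg_of_hasDerivWithinAt_ge_neg_mul {φ φ' : ℝ → ℝ} {α T : ℝ} (hT : 0 ≤ T)
    (hφ : ∀ t ∈ Icc 0 T, HasDerivWithinAt φ (φ' t) (Ici 0) t)
    (hle : ∀ t ∈ Icc 0 T, 0 ≤ φ' t + α * φ t) (h0 : 0 ≤ φ 0) : 0 ≤ φ T := by
  have hder : ∀ t ∈ Icc 0 T, HasDerivWithinAt (fun s => Real.exp (α * s) * φ s)
      (Real.exp (α * t) * (α * 1) * φ t + Real.exp (α * t) * φ' t) (Icc 0 T) t := fun t ht =>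
    (((hasDerivAt_id t).const_mul α).exp.hasDerivWithinAt).mul ((hφ t ht).mono Icc_subset_Ici_self)
  have hmono : MonotoneOn (fun s => Real.exp (α * s) * φ s) (Icc 0 T) :=
    monotoneOn_of_hasDerivWithinAt_nonneg (convex_Icc 0 T)
      (fun t ht => (hder t ht).continuousWithinAt)
      (fun t ht => (hder t (interior_subset ht)).mono interior_subset) fun t ht => by
        have := mul_nonneg (Real.exp_pos (α * t)).le (hle t (interior_subset ht))
        linarith
  have h := hmono (left_mem_Icc.2 hT) (right_mem_Icc.2 hT) hT
  simp only [mul_zero, Real.exp_zero, one_mul] at h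
  exact nonneg_of_mul_nonneg_right (h0.trans h) (Real.exp_pos _)

theorem LipschitzOnWith.exists_global_solution_extension {k l : ℕ}
    {F₁ : EuclideanSpace ℝ (Fin k) × EuclideanSpace ℝ (Fin l) → EuclideanSpace ℝ (Fin k)}
    {F₂ : EuclideanSpace ℝ (Fin k) × EuclideanSpace ℝ (Fin l) → EuclideanSpace ℝ (Fin l)}
    {K₁ K₂ : NNReal} {s : Set (EuclideanSpace ℝ (Fin k) × EuclideanSpace ℝ (Fin l))}
    (hs : IsCompact s) (h₁ : LipschitzOnWith K₁ F₁ s) (h₂ : LipschitzOnWith K₂ F₂ s)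
    (p : EuclideanSpace ℝ (Fin k) × EuclideanSpace ℝ (Fin l)) :
    ∃ y : ℝ → EuclideanSpace ℝ (Fin k) × EuclideanSpace ℝ (Fin l),
      y 0 = p ∧ ContinuousOn y (Ici 0) ∧ ∀ t, 0 ≤ t → y t ∈ s →
        HasDerivWithinAt (fun τ => (y τ).1) (F₁ (y t)) (Ici 0) t ∧
        HasDerivWithinAt (fun τ => (y τ).2) (F₂ (y t)) (Ici 0) t := by
  obtain ⟨M₁, hM₁⟩ := hs.exists_bound_of_continuousOn h₁.continuousOn
  obtain ⟨M₂, hM₂⟩ := hs.exists_bound_of_continuousOn h₂.continuousOn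
  obtain ⟨G₁, L₁, B₁, hG₁, hFG₁, hB₁⟩ := h₁.exists_bounded_extension hM₁
  obtain ⟨G₂, L₂, B₂, hG₂, hFG₂, hB₂⟩ := h₂.exists_bounded_extension hM₂
  obtain ⟨y, hy0, hy⟩ := (hG₁.prodMk hG₂).exists_global_solution (M := max B₁ B₂)
    (fun x => max_le_max (hB₁ x) (hB₂ x)) p
  refine ⟨y, hy0, fun t ht => (hy t ht).continuousWithinAt, fun t ht hts => ?_⟩
  rw [hFG₁ hts, hFG₂ hts]
  exact ⟨(hy t ht).fst, (hy t ht).snd⟩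

theorem fderiv_comp_prodMk_right {E F G : Type*} [NormedAddCommGroup E] [NormedSpace ℝ E]
    [NormedAddCommGroup F] [NormedSpace ℝ F] [NormedAddCommGroup G] [NormedSpace ℝ G]
    {H : E × F → G} {p : E × F} (hH : DifferentiableAt ℝ H p) (v : E) :
    fderiv ℝ (fun x => H (x, p.2)) p.1 v = fderiv ℝ H p (v, 0) := by
  have := HasFDerivAt.comp p.1 (f := fun x : E => (x, p.2)) (g := H) hH.hasFDerivAt
    (hasFDerivAt_prodMk_left p.1 p.2)
  rw [HasFDerivAt.fderiv (f := fun x => H (x, p.2)) this]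
  rfl

theorem fderiv_comp_prodMk_left {E F G : Type*} [NormedAddCommGroup E] [NormedSpace ℝ E]
    [NormedAddCommGroup F] [NormedSpace ℝ F] [NormedAddCommGroup G] [NormedSpace ℝ G]
    {H : E × F → G} {p : E × F} (hH : DifferentiableAt ℝ H p) (v : F) :
    fderiv ℝ (fun u => H (p.1, u)) p.2 v = fderiv ℝ H p (0, v) := by
  have := HasFDerivAt.comp p.2 (f := fun u : F => (p.1, u)) (g := H) hH.hasFDerivAt
    (hasFDerivAt_prodMk_right p.1 p.2)
  rw [HasFDerivAt.fderiv (f := fun u => H (p.1, u)) this]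
  rfl

theorem contDiff_hseq {n m r : ℕ}
    {f : EuclideanSpace ℝ (Fin n) × EuclideanSpace ℝ (Fin m) → EuclideanSpace ℝ (Fin n)}
    {h : EuclideanSpace ℝ (Fin n) → ℝ} (β : ℝ)
    (hf : ContDiff ℝ (r + 1 : ℕ) f) (hh : ContDiff ℝ (r + 2 : ℕ) h) :
    ∀ i k : ℕ, i + k = r + 2 → ContDiff ℝ k (hseq f h β i) := by
  intro i
  induction i with
  | zero =>
    intro k hk
    have : k = r + 2 := by omega
    subst this
    exact hh.comp contDiff_fst
  | succ i ih =>
    intro k hk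
    have hi : ContDiff ℝ (k + 1 : ℕ) (hseq f h β i) := ih (k + 1) (by omega)
    have heq : hseq f h β (i + 1) =
        fun p => fderiv ℝ (hseq f h β i) p (f p, 0) + β * hseq f h β i p := by
      funext p
      change fderiv ℝ (fun x => hseq f h β i (x, p.2)) p.1 (f p) + β * hseq f h β i p = _
      rw [fderiv_comp_prodMk_right (hi.differentiable (by simp) p)]
    have hfk : ContDiff ℝ k f := hf.of_le (by exact_mod_cast (by omega : k ≤ r + 1))
    have hik : ContDiff ℝ k (hseq f h β i) := hi.of_le (by exact_mod_cast k.le_succ)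
    rw [heq]
    exact ((hi.fderiv_right (by simp)).clm_apply (hfk.prodMk contDiff_const)).add
      (contDiff_const.mul hik)

theorem hseq_eq_of_steady {n m : ℕ}
    {f : EuclideanSpace ℝ (Fin n) × EuclideanSpace ℝ (Fin m) → EuclideanSpace ℝ (Fin n)}
    (h : EuclideanSpace ℝ (Fin n) → ℝ) (β : ℝ)
    {p : EuclideanSpace ℝ (Fin n) × EuclideanSpace ℝ (Fin m)} (hp : f p = 0) (i : ℕ) :
    hseq f h β i p = β ^ i * h p.1 := by
  induction i with
  | zero => simp [hseq]
  | succ i ih =>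
    change fderiv ℝ (fun x => hseq f h β i (x, p.2)) p.1 (f p) + β * hseq f h β i p = _
    rw [hp, map_zero, ih, pow_succ]
    ring

theorem eventually_zero_satisfies_state_constraint {n m r : ℕ}
    {f : EuclideanSpace ℝ (Fin n) × EuclideanSpace ℝ (Fin m) → EuclideanSpace ℝ (Fin n)}
    {h : EuclideanSpace ℝ (Fin n) → ℝ} {β γ : ℝ} (hβ : 0 < β) (hγ : 0 < γ)
    (hf : ContDiff ℝ (r + 1 : ℕ) f) (hh : ContDiff ℝ (r + 2 : ℕ) h)
    {p₀ : EuclideanSpace ℝ (Fin n) × EuclideanSpace ℝ (Fin m)} (hp₀ : f p₀ = 0)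
    (hhp₀ : 0 < h p₀.1) :
    ∀ᶠ p in 𝓝 p₀, 0 ≤ fderiv ℝ (fun x => hseq f h β r (x, p.2)) p.1 (f p)
      + γ * hseq f h β r p := by
  have hH : ContDiff ℝ (2 : ℕ) (hseq f h β r) := contDiff_hseq β hf hh r 2 rfl
  have hHd : Differentiable ℝ (hseq f h β r) := hH.differentiable (by simp)
  have hcont : Continuous fun p => fderiv ℝ (hseq f h β r) p (f p, 0) + γ * hseq f h β r p :=
    ((hH.continuous_fderiv (by simp)).clm_apply (hf.continuous.prodMk continuous_const)).add
      (continuous_const.mul hH.continuous)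
  have hpos : 0 < fderiv ℝ (hseq f h β r) p₀ (f p₀, 0) + γ * hseq f h β r p₀ := by
    rw [hp₀, hseq_eq_of_steady h β hp₀, Prod.mk_zero_zero, map_zero]
    positivity
  filter_upwards [hcont.continuousAt.eventually_const_lt hpos] with p hp
  rw [fderiv_comp_prodMk_right (hHd p)]
  exact hp.le

theorem inner_le_zero_of_isMinOn_norm_add_sq {E : Type*} [NormedAddCommGroup E]
    [InnerProductSpace ℝ E] {C : Set E} {c q : E}
    (hC : ∀ s ∈ Ioo (0 : ℝ) 1, (1 - s) • q ∈ C)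
    (hmin : IsMinOn (fun z => (1 / 2) * ‖z + c‖ ^ 2) C q) : ⟪q + c, q⟫ ≤ 0 := by
  have hs : ∀ s ∈ Ioo (0 : ℝ) 1, ⟪q + c, q⟫ ≤ s * (‖q‖ ^ 2 / 2) := by
    intro s hs
    have h1 : (1 / 2) * ‖q + c‖ ^ 2 ≤ (1 / 2) * ‖(1 - s) • q + c‖ ^ 2 := hmin (hC s hs)
    have h2 : (1 - s) • q + c = (q + c) - s • q := by module
    rw [h2, norm_sub_sq_real, inner_smul_right, norm_smul, mul_pow, Real.norm_eq_abs, sq_abs] at h1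
    have h3 : s * ⟪q + c, q⟫ ≤ s * (s * (‖q‖ ^ 2 / 2)) := by linarith
    exact le_of_mul_le_mul_left h3 hs.1
  have hlim : Tendsto (fun s : ℝ => s * (‖q‖ ^ 2 / 2)) (𝓝[>] 0) (𝓝 0) := by
    have : Continuous fun s : ℝ => s * (‖q‖ ^ 2 / 2) := by fun_prop
    simpa using (this.tendsto 0).mono_left nhdsWithin_le_nhds
  exact ge_of_tendsto hlim (eventually_of_mem (Ioo_mem_nhdsGT one_pos) hs)

theorem fderiv_comp_apply_le_of_isMinOn_QPobj {n m r : ℕ}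
    {f : EuclideanSpace ℝ (Fin n) × EuclideanSpace ℝ (Fin m) → EuclideanSpace ℝ (Fin n)}
    {h : EuclideanSpace ℝ (Fin n) → ℝ} {b : EuclideanSpace ℝ (Fin m) → ℝ} {β α γ ε : ℝ}
    {Φ : EuclideanSpace ℝ (Fin n) → ℝ} {w : EuclideanSpace ℝ (Fin m) → EuclideanSpace ℝ (Fin n)}
    {p : EuclideanSpace ℝ (Fin n) × EuclideanSpace ℝ (Fin m)} {q : EuclideanSpace ℝ (Fin m)}
    (hε : 0 < ε) (hα : 0 < α) (hb : 0 ≤ b p.2)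
    (hstate : 0 ≤ fderiv ℝ (fun x => hseq f h β r (x, p.2)) p.1 (f p) + γ * hseq f h β r p)
    (hq : q ∈ QPfeas f h b β r α γ p)
    (hmin : IsMinOn (QPobj Φ w ε p) (QPfeas f h b β r α γ p) q) :
    fderiv ℝ Φ p.1 (fderiv ℝ w p.2 q) ≤ -(‖q‖ ^ 2 / ε) := by
  have hseg : ∀ s ∈ Ioo (0 : ℝ) 1, (1 - s) • q ∈ QPfeas f h b β r α γ p := by
    rintro s ⟨hs0, hs1⟩
    have hs2 : 0 ≤ 1 - s := by linarith
    constructor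
    · rw [inner_smul_right]
      linarith [mul_nonneg hs2 hq.1, mul_nonneg hs0.le (mul_nonneg hα.le hb)]
    · rw [map_smul, smul_eq_mul]
      linarith [mul_nonneg hs2 hq.2, mul_nonneg hs0.le hstate]
  have hinner := inner_le_zero_of_isMinOn_norm_add_sq hseg hmin
  rw [inner_add_left, real_inner_self_eq_norm_sq, inner_smul_left,
    ContinuousLinearMap.adjoint_inner_left, gradient, InnerProductSpace.toDual_symm_apply] at hinner
  simp only [conj_trivial] at hinner
  rw [← neg_div, le_div_iff₀ hε]
  linarith

theorem exists_eventually_norm_fderiv_sub_mul_le {E F : Type*} [NormedAddCommGroup E]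
    [NormedSpace ℝ E] [NormedAddCommGroup F] [NormedSpace ℝ F] {Φ : E → ℝ} {w : F → E}
    (hΦ : ContDiff ℝ 2 Φ) (hw : ContDiff ℝ 2 w) (u₀ : F) :
    ∃ L : ℝ, 0 ≤ L ∧ ∀ᶠ p : E × F in 𝓝 (w u₀, u₀),
      ‖fderiv ℝ Φ (w p.2) - fderiv ℝ Φ p.1‖ * ‖fderiv ℝ w p.2‖ ≤ L * ‖p.1 - w p.2‖ := by
  have hΦ' : ContDiff ℝ 1 (fderiv ℝ Φ) := hΦ.fderiv_right (by norm_num)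
  obtain ⟨K, U, hU, hK⟩ := hΦ'.contDiffAt.exists_lipschitzOnWith (x := w u₀)
  have hw' : Continuous fun u => ‖fderiv ℝ w u‖ := (hw.continuous_fderiv (by simp)).norm
  have hlt : ∀ᶠ p : E × F in 𝓝 (w u₀, u₀), ‖fderiv ℝ w p.2‖ < ‖fderiv ℝ w u₀‖ + 1 :=
    (hw'.comp continuous_snd).continuousAt.eventually_lt_const (lt_add_one _)
  have hx : ∀ᶠ p : E × F in 𝓝 (w u₀, u₀), p.1 ∈ U := continuous_fst.continuousAt.eventually_mem hU
  have hwu : ∀ᶠ p : E × F in 𝓝 (w u₀, u₀), w p.2 ∈ U :=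
    (hw.continuous.comp continuous_snd).continuousAt.eventually_mem hU
  refine ⟨K * (‖fderiv ℝ w u₀‖ + 1), by positivity, ?_⟩
  filter_upwards [hlt, hx, hwu] with p h1 h2 h3
  have h4 : ‖fderiv ℝ Φ (w p.2) - fderiv ℝ Φ p.1‖ ≤ K * ‖p.1 - w p.2‖ := by
    rw [norm_sub_rev, ← dist_eq_norm, ← dist_eq_norm]
    exact hK.dist_le_mul _ h2 _ h3
  calc _ ≤ K * ‖p.1 - w p.2‖ * (‖fderiv ℝ w u₀‖ + 1) := by gcongr
    _ = _ := by ring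

theorem lyapunov_derivative_le {w₁ w₂ φ₁ φ₂ a c d₃ d₄ L ε : ℝ}
    (hd₄ : 0 < d₄) (hL : 0 ≤ L) (hε : 0 < ε) (hεs : ε < d₃ / (d₄ + L) ^ 2)
    (hw₁ : w₁ ≤ -d₃ * a ^ 2) (hw₂ : w₂ ≤ d₄ * a * c) (hφ₁ : φ₁ ≤ -(c ^ 2 / ε))
    (hφ₂ : φ₂ ≤ L * a * c) :
    w₁ + w₂ + (φ₁ + φ₂) ≤ -(d₃ / 2 * a ^ 2 + c ^ 2 / (2 * ε)) := by
  have hM : ε * (d₄ + L) ^ 2 ≤ d₃ := ((lt_div_iff₀ (by positivity)).1 hεs).le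
  have hcross : (d₄ + L) * a * c ≤ d₃ / 2 * a ^ 2 + c ^ 2 / (2 * ε) := by
    have h1 : 0 ≤ (ε * ((d₄ + L) * a) - c) ^ 2 / (2 * ε) := by positivity
    have h2 : (ε * ((d₄ + L) * a) - c) ^ 2 / (2 * ε) =
        (ε * (d₄ + L) ^ 2) / 2 * a ^ 2 - (d₄ + L) * a * c + c ^ 2 / (2 * ε) := by
      field_simp
      ring
    nlinarith [mul_le_mul_of_nonneg_right hM (sq_nonneg a)]
  have h3 : c ^ 2 / ε = c ^ 2 / (2 * ε) + c ^ 2 / (2 * ε) := by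
    field_simp
    ring
  linarith

/-- Theorem 1 (Convergence to optima). Under the steady-state, relative-degree, Lyapunov-function,
compact-sublevel-set and interiority assumptions, and assuming that for all parameter choices the
controller QP is feasible on a neighborhood `N` of `(x*,u*)`, its minimizer map is locally
Lipschitz on `N`, and `(x*,u*)` is the only closed-loop equilibrium in `N`, then for any fixed
`α > 0` there exist `ε* > 0` and `γ* > 0` such that for every `ε ∈ (0,ε*)` and `γ ≥ γ*`, the
point `(x*,u*)` is locally asymptotically stable relative to `X_r` for the closed-loop system. -/
theorem convergence_to_optima
    {n m r : ℕ} (hn : 0 < n) (hm : 0 < m) (hrpos : 0 < r)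
    (f : EuclideanSpace ℝ (Fin n) × EuclideanSpace ℝ (Fin m) → EuclideanSpace ℝ (Fin n))
    (h : EuclideanSpace ℝ (Fin n) → ℝ) (b : EuclideanSpace ℝ (Fin m) → ℝ)
    (hf : ContDiff ℝ (r + 1 : ℕ) f) (hh : ContDiff ℝ (r + 2 : ℕ) h) (hb : ContDiff ℝ 2 b)
    (β : ℝ) (hβ : 0 < β)
    (Φ : EuclideanSpace ℝ (Fin n) → ℝ) (w : EuclideanSpace ℝ (Fin m) → EuclideanSpace ℝ (Fin n))
    (hΦ : ContDiff ℝ 2 Φ) (hw : ContDiff ℝ 2 w)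
    -- (i) steady-state map
    (hsteady : ∀ u, f (w u, u) = 0)
    -- (ii) relative degree
    (hrel : ∀ (p : EuclideanSpace ℝ (Fin n) × EuclideanSpace ℝ (Fin m)), ∀ i < r,
      fderiv ℝ (fun u => hseq f h β i (p.1, u)) p.2 = 0)
    -- (iii) Lyapunov function for the plant
    (W : EuclideanSpace ℝ (Fin n) × EuclideanSpace ℝ (Fin m) → ℝ) (hW : ContDiff ℝ 1 W)
    (d₁ d₂ d₃ d₄ : ℝ) (hd₁ : 0 < d₁) (hd₂ : 0 < d₂) (hd₃ : 0 < d₃) (hd₄ : 0 < d₄)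
    (hWbound : ∀ p : EuclideanSpace ℝ (Fin n) × EuclideanSpace ℝ (Fin m),
      d₁ * ‖p.1 - w p.2‖ ^ 2 ≤ W p ∧ W p ≤ d₂ * ‖p.1 - w p.2‖ ^ 2)
    (hWdecr : ∀ p : EuclideanSpace ℝ (Fin n) × EuclideanSpace ℝ (Fin m),
      fderiv ℝ (fun x => W (x, p.2)) p.1 (f p) ≤ -d₃ * ‖p.1 - w p.2‖ ^ 2)
    (hWu : ∀ p : EuclideanSpace ℝ (Fin n) × EuclideanSpace ℝ (Fin m),
      ‖fderiv ℝ (fun u => W (p.1, u)) p.2‖ ≤ d₄ * ‖p.1 - w p.2‖)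
    -- (iv) compact sublevel sets of u ↦ Φ(w(u))
    (hlevel : ∀ c : ℝ, IsCompact {u : EuclideanSpace ℝ (Fin m) | Φ (w u) ≤ c})
    -- (v) the point (x*,u*)
    (xs : EuclideanSpace ℝ (Fin n)) (us : EuclideanSpace ℝ (Fin m))
    (hxs : xs = w us) (hbus : 0 ≤ b us) (hhxs : 0 < h xs)
    -- (vi) the neighborhood N
    (N : Set (EuclideanSpace ℝ (Fin n) × EuclideanSpace ℝ (Fin m)))
    (hNopen : IsOpen N) (hNmem : (xs, us) ∈ N)
    (hlocmin : ∀ p ∈ N, p.2 ≠ us → Φ (w us) < Φ (w p.2))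
    (hfeasN : ∀ ε > (0 : ℝ), ∀ α > (0 : ℝ), ∀ γ > (0 : ℝ),
      ∀ p ∈ N, (QPfeas f h b β r α γ p).Nonempty)
    (hgN : ∀ ε > (0 : ℝ), ∀ α > (0 : ℝ), ∀ γ > (0 : ℝ),
      ∀ g : EuclideanSpace ℝ (Fin n) × EuclideanSpace ℝ (Fin m) → EuclideanSpace ℝ (Fin m),
      (∀ p ∈ N, g p ∈ QPfeas f h b β r α γ p ∧
        IsMinOn (QPobj Φ w ε p) (QPfeas f h b β r α γ p) (g p)) →
      (∀ p ∈ N, ∃ K : NNReal, ∃ V ∈ nhdsWithin p N, LipschitzOnWith K g V) ∧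
      (∀ p ∈ N, p.1 = w p.2 → g p = 0 → p = (xs, us))) :
    -- conclusion: local asymptotic stability relative to X_r
    ∀ α > (0 : ℝ), ∃ εs > (0 : ℝ), ∃ γs > (0 : ℝ),
      ∀ ε, 0 < ε → ε < εs → ∀ γ ≥ γs,
      ∀ g : EuclideanSpace ℝ (Fin n) × EuclideanSpace ℝ (Fin m) → EuclideanSpace ℝ (Fin m),
      (∀ p ∈ N, g p ∈ QPfeas f h b β r α γ p ∧
        IsMinOn (QPobj Φ w ε p) (QPfeas f h b β r α γ p) (g p)) →
      ∀ V ∈ nhds ((xs, us) : EuclideanSpace ℝ (Fin n) × EuclideanSpace ℝ (Fin m)),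
      ∃ V' ∈ nhds ((xs, us) : EuclideanSpace ℝ (Fin n) × EuclideanSpace ℝ (Fin m)),
        (∀ p ∈ V' ∩ Xset f h b β r,
          ∃ ξ : ℝ → EuclideanSpace ℝ (Fin n), ∃ υ : ℝ → EuclideanSpace ℝ (Fin m),
            (ξ 0, υ 0) = p ∧
            ∀ t ∈ Ici (0 : ℝ),
              HasDerivWithinAt ξ (f (ξ t, υ t)) (Ici 0) t ∧
              HasDerivWithinAt υ (g (ξ t, υ t)) (Ici 0) t) ∧
        (∀ (ξ : ℝ → EuclideanSpace ℝ (Fin n)) (υ : ℝ → EuclideanSpace ℝ (Fin m)),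
          (ξ 0, υ 0) ∈ V' ∩ Xset f h b β r →
          (∀ t ∈ Ici (0 : ℝ),
            HasDerivWithinAt ξ (f (ξ t, υ t)) (Ici 0) t ∧
            HasDerivWithinAt υ (g (ξ t, υ t)) (Ici 0) t) →
          (∀ t ∈ Ici (0 : ℝ), (ξ t, υ t) ∈ V) ∧
          Filter.Tendsto (fun t => (ξ t, υ t)) Filter.atTop (nhds (xs, us))) := by
  intro α hα
  obtain ⟨L, hL, hLev⟩ := exists_eventually_norm_fderiv_sub_mul_le hΦ hw us
  refine ⟨d₃ / (d₄ + L) ^ 2, by positivity, 1, one_pos, fun ε hε hεs γ hγ1 g hg V hV => ?_⟩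
  have hγ : 0 < γ := one_pos.trans_le hγ1
  obtain ⟨hglip, hgeq⟩ := hgN ε hε α hα γ hγ g hg
  rw [← hxs] at hLev
  have hp₀ : f (xs, us) = 0 := by rw [hxs, hsteady]
  obtain ⟨Kg, Ug, hUg, hKg⟩ := hglip _ hNmem
  rw [hNopen.nhdsWithin_eq hNmem] at hUg
  obtain ⟨Kf, Uf, hUf, hKf⟩ := ((hf.of_le (by simp) : ContDiff ℝ 1 f).contDiffAt
    (x := (xs, us))).exists_lipschitzOnWith
  have hev : ∀ᶠ p in 𝓝 (xs, us), (p ∈ N ∧ p ∈ Ug ∧ p ∈ Uf ∧ p ∈ V) ∧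
      ‖fderiv ℝ Φ (w p.2) - fderiv ℝ Φ p.1‖ * ‖fderiv ℝ w p.2‖ ≤ L * ‖p.1 - w p.2‖ ∧
      0 ≤ fderiv ℝ (fun x => hseq f h β r (x, p.2)) p.1 (f p) + γ * hseq f h β r p := by
    filter_upwards [hNopen.mem_nhds hNmem, hUg, hUf, hV, hLev,
      eventually_zero_satisfies_state_constraint hβ hγ hf hh hp₀ hhxs] with p h1 h2 h3 h4 h5 h6
    exact ⟨⟨h1, h2, h3, h4⟩, h5, h6⟩
  obtain ⟨ρ, hρ, hball⟩ := Metric.nhds_basis_closedBall.eventually_iff.1 hev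
  set B := Metric.closedBall ((xs, us) : EuclideanSpace ℝ (Fin n) × EuclideanSpace ℝ (Fin m)) ρ
  have hKg' : LipschitzOnWith Kg g B := hKg.mono fun p hp => (hball hp).1.2.1
  have hKf' : LipschitzOnWith Kf f B := hKf.mono fun p hp => (hball hp).1.2.2.1
  set V₀ : EuclideanSpace ℝ (Fin n) × EuclideanSpace ℝ (Fin m) → ℝ :=
    fun p => W p + (Φ (w p.2) - Φ (w us)) with hV₀
  set D : EuclideanSpace ℝ (Fin n) × EuclideanSpace ℝ (Fin m) → ℝ :=
    fun p => d₃ / 2 * ‖p.1 - w p.2‖ ^ 2 + ‖g p‖ ^ 2 / (2 * ε) with hD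
  have hwc : Continuous w := hw.continuous
  have hΦc : Continuous Φ := hΦ.continuous
  have hWc : Continuous W := hW.continuous
  have hV₀c : Continuous V₀ := by fun_prop
  have hDc : ContinuousOn D B := by
    have h1 := hKg'.continuousOn
    have h2 : Continuous fun p : EuclideanSpace ℝ (Fin n) × EuclideanSpace ℝ (Fin m) =>
      d₃ / 2 * ‖p.1 - w p.2‖ ^ 2 := by fun_prop
    exact h2.continuousOn.add ((h1.norm.pow 2).div_const _)
  have hV₀zero : V₀ (xs, us) = 0 := by
    have := hWbound (xs, us)
    simp only [← hxs, sub_self, norm_zero] at this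
    simp only [hV₀]
    linarith
  have hV₀pos : ∀ p ∈ B, p ≠ (xs, us) → 0 < V₀ p := by
    intro p hp hne
    have h1 := (hWbound p).1
    by_cases hu : p.2 = us
    · have hx : p.1 - w p.2 ≠ 0 := by
        rw [hu, ← hxs, sub_ne_zero]
        exact fun hx => hne (Prod.ext hx hu)
      have h2 : 0 < d₁ * ‖p.1 - w p.2‖ ^ 2 := by positivity
      simp only [hV₀, hu, sub_self] at h2 ⊢
      rw [hu] at h1
      linarith
    · have h2 := hlocmin p (hball hp).1.1 hu
      have h3 : 0 ≤ d₁ * ‖p.1 - w p.2‖ ^ 2 := by positivity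
      simp only [hV₀]
      linarith
  have hDpos : ∀ p ∈ B, p ≠ (xs, us) → 0 < D p := by
    intro p hp hne
    by_cases hx : p.1 - w p.2 = 0
    · have hg0 : g p ≠ 0 := fun h0 => hne (hgeq p (hball hp).1.1 (sub_eq_zero.1 hx) h0)
      simp only [hD]
      positivity
    · simp only [hD]
      positivity
  obtain ⟨U, hU, hstab⟩ := exists_nhds_stable_and_attracted hρ hV₀c.continuousOn hV₀zero hV₀pos
    hDc (fun p _ => by simp only [hD]; positivity) hDpos
  have hdecay : ∀ p ∈ B, 0 ≤ b p.2 →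
      fderiv ℝ W p (f p, g p) + fderiv ℝ Φ (w p.2) (fderiv ℝ w p.2 (g p)) ≤ -D p := by
    intro p hp hbp
    obtain ⟨⟨hpN, -⟩, hLp, hstate⟩ := hball hp
    have hWd : DifferentiableAt ℝ W p := hW.differentiable (by simp) p
    have h1 : fderiv ℝ W p (f p, 0) ≤ -d₃ * ‖p.1 - w p.2‖ ^ 2 :=
      (fderiv_comp_prodMk_right hWd (f p)).symm.trans_le (hWdecr p)
    have h2 : fderiv ℝ W p (0, g p) ≤ d₄ * ‖p.1 - w p.2‖ * ‖g p‖ := by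
      rw [← fderiv_comp_prodMk_left hWd (g p)]
      exact (Real.le_norm_self _).trans (ContinuousLinearMap.le_of_opNorm_le _ (hWu p) _)
    have h3 := fderiv_comp_apply_le_of_isMinOn_QPobj hε hα hbp hstate (hg p hpN).1 (hg p hpN).2
    have h4 : (fderiv ℝ Φ (w p.2) - fderiv ℝ Φ p.1) (fderiv ℝ w p.2 (g p)) ≤
        L * ‖p.1 - w p.2‖ * ‖g p‖ := by
      refine (Real.le_norm_self _).trans ((ContinuousLinearMap.le_opNorm _ _).trans ?_)
      calc _ ≤ ‖fderiv ℝ Φ (w p.2) - fderiv ℝ Φ p.1‖ * (‖fderiv ℝ w p.2‖ * ‖g p‖) := by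
            gcongr
            exact ContinuousLinearMap.le_opNorm _ _
        _ ≤ L * ‖p.1 - w p.2‖ * ‖g p‖ := by
            rw [← mul_assoc]
            gcongr
    have h5 := lyapunov_derivative_le hd₄ hL hε hεs h1 h2 h3 h4
    have h6 : ((f p, g p) : EuclideanSpace ℝ (Fin n) × EuclideanSpace ℝ (Fin m)) =
        (f p, 0) + (0, g p) := by simp
    rw [h6, map_add]
    rw [sub_apply] at h5
    simp only [hD]
    linarith
  have hsol : ∀ y : ℝ → EuclideanSpace ℝ (Fin n) × EuclideanSpace ℝ (Fin m),
      ContinuousOn y (Ici 0) → y 0 ∈ U → 0 ≤ b (y 0).2 →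
      (∀ t, 0 ≤ t → y t ∈ B → HasDerivWithinAt (fun τ => (y τ).1) (f (y t)) (Ici 0) t ∧
        HasDerivWithinAt (fun τ => (y τ).2) (g (y t)) (Ici 0) t) →
      (∀ t, 0 ≤ t → y t ∈ B) ∧ Tendsto y atTop (𝓝 (xs, us)) := by
    intro y hyc hyU hb0 hy
    have hconcl := hstab y hyc hyU ?_
    · exact ⟨fun t ht => Metric.ball_subset_closedBall (hconcl.1 t ht), hconcl.2⟩
    intro t ht hmem
    have hbt : 0 ≤ b (y t).2 := by
      refine nonneg_of_hasDerivWithinAt_ge_neg_mul (φ := fun s => b (y s).2)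
        (φ' := fun s => fderiv ℝ b (y s).2 (g (y s))) (α := α) ht (fun s hs => ?_)
        (fun s hs => ?_) hb0
      · exact (hb.differentiable (by simp) (y s).2).hasFDerivAt.comp_hasDerivWithinAt s
          (hy s hs.1 (hmem s hs)).2
      · have := (hg (y s) (hball (hmem s hs)).1.1).1.1
        rwa [gradient, InnerProductSpace.toDual_symm_apply] at this
    obtain ⟨hy1, hy2⟩ := hy t ht (hmem t ⟨ht, le_rfl⟩)
    refine ⟨_, ?_, hdecay (y t) (hmem t ⟨ht, le_rfl⟩) hbt⟩
    have hWy := (hW.differentiable (by simp) (y t)).hasFDerivAt.comp_hasDerivWithinAt t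
      (hy1.prodMk hy2)
    have hwy := (hw.differentiable (by simp) (y t).2).hasFDerivAt.comp_hasDerivWithinAt t hy2
    have hΦy := (hΦ.differentiable (by simp) (w (y t).2)).hasFDerivAt.comp_hasDerivWithinAt t hwy
    exact hWy.add (hΦy.sub_const _)
  refine ⟨U, hU, fun p hp => ?_, fun ξ υ h0 hode => ?_⟩
  · obtain ⟨y, hy0, hyc, hy⟩ := LipschitzOnWith.exists_global_solution_extension
      (isCompact_closedBall (xs, us) ρ) hKf' hKg' p
    have hmem := (hsol y hyc (hy0 ▸ hp.1) (hy0 ▸ hp.2.2.1) hy).1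
    exact ⟨fun t => (y t).1, fun t => (y t).2, hy0, fun t ht => hy t ht (hmem t ht)⟩
  · have hcont : ContinuousOn (fun t => (ξ t, υ t)) (Ici 0) := fun t ht =>
      ((hode t ht).1.prodMk (hode t ht).2).continuousWithinAt
    obtain ⟨hmem, hlim⟩ := hsol _ hcont h0.1 h0.2.2.1 fun t ht _ => hode t ht
    exact ⟨fun t ht => (hball (hmem t ht)).1.2.2.2, hlim⟩
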